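/- arXiv:2502.03701 — 4 statements merged into one kernel-verified Lean document; each statement's English description precedes it below -/
import Mathlib

section
/- Let f : ℝ^d → ℝ be twice continuously differentiable, c ≠ 0 a real number, and define the scalar reparameterization f̄(y) = f(c·y), so that ∇f̄(y) = c ∇f(cy) and ∇²f̄(y) = c² ∇²f(cy). Fix positive step sizes (α_k)_{k≥0} and consider the CG-scaled gradient iterations x_{k+1} = x_k − α_k s_CG(x_k) ∇f(x_k) on f and y_{k+1} = y_k − α_k s̄_CG(y_k) ∇f̄(y_k) on f̄, where s_CG(x) = ‖∇f(x)‖²/⟨∇f(x), ∇²f(x) ∇f(x)⟩ and s̄_CG(y) = ‖∇f̄(y)‖²/⟨∇f̄(y), ∇²f̄(y) ∇f̄(y)⟩, assuming ⟨∇f(x_k), ∇²f(x_k) ∇f(x_k)⟩ ≠ 0 at every iterate x_k. If y_0 = x_0/c, then y_k = x_k/c for all k ≥ 0. -/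
open scoped RealInnerProductSpace

/-- The CG scaling at `x`. -/
noncomputable def sCG {d : ℕ} (f : EuclideanSpace ℝ (Fin d) → ℝ)
    (x : EuclideanSpace ℝ (Fin d)) : ℝ :=
  ‖gradient f x‖ ^ 2 /
    ⟪gradient f x, fderiv ℝ (gradient f) x (gradient f x)⟫

/-- Rescaling the argument by `c` rescales the gradient by `c`. -/
theorem gradient_comp_smul {d : ℕ} (f : EuclideanSpace ℝ (Fin d) → ℝ) (c : ℝ)
    (y : EuclideanSpace ℝ (Fin d)) :
    gradient (fun z => f (c • z)) y = c • gradient f (c • y) := by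
  simp [gradient, fderiv_comp_smul]

/-- Rescaling the argument by `c` rescales the Hessian by `c ^ 2`. -/
theorem fderiv_gradient_comp_smul {d : ℕ} (f : EuclideanSpace ℝ (Fin d) → ℝ) (c : ℝ)
    (y : EuclideanSpace ℝ (Fin d)) :
    fderiv ℝ (gradient fun z => f (c • z)) y = c ^ 2 • fderiv ℝ (gradient f) (c • y) := by
  have h : (gradient fun z => f (c • z)) = c • fun z => gradient f (c • z) :=
    funext fun z => gradient_comp_smul f c z
  rw [h, fderiv_const_smul_field, Pi.smul_apply, fderiv_comp_smul, smul_smul, sq]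

/-- Rescaling the argument by `c` rescales the CG scaling by `(c ^ 2)⁻¹`. -/
theorem sCG_comp_smul {d : ℕ} (f : EuclideanSpace ℝ (Fin d) → ℝ) {c : ℝ} (hc : c ≠ 0)
    (y : EuclideanSpace ℝ (Fin d)) :
    sCG (fun z => f (c • z)) y = (c ^ 2)⁻¹ * sCG f (c • y) := by
  simp only [sCG, fderiv_gradient_comp_smul, gradient_comp_smul, norm_smul, mul_pow,
    Real.norm_eq_abs, sq_abs, smul_apply, map_smul, inner_smul_left,
    inner_smul_right, conj_trivial]
  rw [← mul_assoc, ← mul_assoc, show c * c ^ 2 * c = c ^ 2 * c ^ 2 by ring, mul_assoc,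
    mul_div_mul_left _ _ (pow_ne_zero 2 hc), div_mul_eq_div_div_swap, div_eq_inv_mul]

/-- Scalar invariance of CG-scaled gradient descent. -/
theorem stmt_4 {d : ℕ} (f : EuclideanSpace ℝ (Fin d) → ℝ) (hf : ContDiff ℝ 2 f)
    (c : ℝ) (hc : c ≠ 0)
    (fbar : EuclideanSpace ℝ (Fin d) → ℝ) (hfbar : fbar = fun y => f (c • y))
    (α : ℕ → ℝ) (hα : ∀ k, 0 < α k)
    (x y : ℕ → EuclideanSpace ℝ (Fin d))
    (hx : ∀ k, x (k + 1) = x k - (α k * sCG f (x k)) • gradient f (x k))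
    (hy : ∀ k, y (k + 1) = y k - (α k * sCG fbar (y k)) • gradient fbar (y k))
    (hcurv : ∀ k,
      ⟪gradient f (x k), fderiv ℝ (gradient f) (x k) (gradient f (x k))⟫ ≠ 0)
    (h0 : y 0 = c⁻¹ • x 0) :
    ∀ k, y k = c⁻¹ • x k := by
  subst hfbar
  intro k
  induction k with
  | zero => exact h0
  | succ k ih =>
    have hxy : c • y k = x k := by rw [ih, smul_inv_smul₀ hc]
    rw [hy, hx, sCG_comp_smul f hc, gradient_comp_smul, hxy, ih, smul_sub, smul_smul, smul_smul]
    congr 2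
    field_simp
end

section
/- Let f : ℝ^d → ℝ be twice continuously differentiable and satisfy Hessian directional smoothness with constant L₂ > 0, and let ρ ∈ (0, 1/2) and σ > 0. Fix x with g(x) ≠ 0 and let p = −s g(x) with 0 < s ≤ 1/σ satisfy the second-order descent condition ⟨g(x), p⟩ + ⟨p, H(x) p⟩ ≤ 0. Then every step size α with 0 < α ≤ min{1, √(6σ(1/2 − ρ)/(L₂‖p‖))} satisfies the Armijo condition f(x + α p) ≤ f(x) + ρ α ⟨p, g(x)⟩. -/
open scoped RealInnerProductSpace

/-- The Hessian of `f` at `x`, as a continuous linear map. -/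
noncomputable def hessian {d : ℕ} (f : EuclideanSpace ℝ (Fin d) → ℝ)
    (x : EuclideanSpace ℝ (Fin d)) :
    EuclideanSpace ℝ (Fin d) →L[ℝ] EuclideanSpace ℝ (Fin d) :=
  fderiv ℝ (gradient f) x

theorem le_of_hasDerivAt_le {u v u' v' : ℝ → ℝ} (hu : ∀ t, HasDerivAt u (u' t) t)
    (hv : ∀ t, HasDerivAt v (v' t) t) (h0 : u 0 ≤ v 0) (h : ∀ t, 0 ≤ t → u' t ≤ v' t)
    {t : ℝ} (ht : 0 ≤ t) : u t ≤ v t :=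
  image_le_of_deriv_right_le_deriv_boundary (a := 0) (b := t)
    (fun y _ => (hu y).continuousAt.continuousWithinAt) (fun y _ => (hu y).hasDerivWithinAt) h0
    (fun y _ => (hv y).continuousAt.continuousWithinAt) (fun y _ => (hv y).hasDerivWithinAt)
    (fun y hy => h y hy.1) ⟨ht, le_rfl⟩

/-- A Taylor upper bound for a function whose second derivative grows at most affinely. -/
theorem taylor_upper_bound {u u' u'' : ℝ → ℝ} (hu : ∀ t, HasDerivAt u (u' t) t)
    (hu' : ∀ t, HasDerivAt u' (u'' t) t) {a b : ℝ} (h : ∀ t, 0 ≤ t → u'' t ≤ a + b * t)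
    {t : ℝ} (ht : 0 ≤ t) : u t ≤ u 0 + u' 0 * t + a * t ^ 2 / 2 + b * t ^ 3 / 6 := by
  have hderiv : ∀ t, 0 ≤ t → u' t ≤ u' 0 + a * t + b * t ^ 2 / 2 := by
    intro t ht
    refine le_of_hasDerivAt_le hu' (v := fun t => u' 0 + a * t + b * t ^ 2 / 2)
      (v' := fun t => a + b * t) (fun y => ?_) (by simp) h ht
    refine ((((hasDerivAt_id y).const_mul a).const_add (u' 0)).add
      (((hasDerivAt_pow 2 y).const_mul b).div_const 2)).congr_deriv ?_
    push_cast
    ring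
  refine le_of_hasDerivAt_le hu (v := fun t => u 0 + u' 0 * t + a * t ^ 2 / 2 + b * t ^ 3 / 6)
    (v' := fun t => u' 0 + a * t + b * t ^ 2 / 2) (fun y => ?_) (by simp) hderiv ht
  refine (((((hasDerivAt_id y).const_mul (u' 0)).const_add (u 0)).add
    (((hasDerivAt_pow 2 y).const_mul a).div_const 2)).add
    (((hasDerivAt_pow 3 y).const_mul b).div_const 6)).congr_deriv ?_
  push_cast
  ring

theorem hasFDerivAt_gradient_of_contDiff {d : ℕ} {f : EuclideanSpace ℝ (Fin d) → ℝ}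
    (hf : ContDiff ℝ 2 f) (x : EuclideanSpace ℝ (Fin d)) :
    HasFDerivAt (gradient f) (hessian f x) x := by
  have h : Differentiable ℝ (fderiv ℝ f) :=
    (hf.fderiv_right (m := 1) (by norm_num)).differentiable (by norm_num)
  have hg : DifferentiableAt ℝ (gradient f) x :=
    (InnerProductSpace.toDual ℝ (EuclideanSpace ℝ (Fin d))).symm.differentiable.differentiableAt.comp
      x (h x)
  exact hg.hasFDerivAt

/-- Small enough step sizes satisfy the Armijo condition in the
non-negative curvature case. -/
theorem stmt_6 {d : ℕ} (f : EuclideanSpace ℝ (Fin d) → ℝ) (hf : ContDiff ℝ 2 f)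
    (L₂ : ℝ) (hL₂ : 0 < L₂)
    (hsmooth : ∀ x : EuclideanSpace ℝ (Fin d), ∀ t : ℝ, 0 ≤ t →
      ‖hessian f (x - t • gradient f x) - hessian f x‖ ≤ t * L₂ * ‖gradient f x‖)
    (ρ σ : ℝ) (hρ : ρ ∈ Set.Ioo (0 : ℝ) (1 / 2)) (hσ : 0 < σ)
    (x : EuclideanSpace ℝ (Fin d)) (hgx : gradient f x ≠ 0)
    (s : ℝ) (hs0 : 0 < s) (hs1 : s ≤ 1 / σ)
    (p : EuclideanSpace ℝ (Fin d)) (hp : p = -(s • gradient f x))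
    (hdesc : ⟪gradient f x, p⟫ + ⟪p, hessian f x p⟫ ≤ 0)
    (α : ℝ) (hα0 : 0 < α)
    (hα1 : α ≤ min 1 (Real.sqrt (6 * σ * (1 / 2 - ρ) / (L₂ * ‖p‖)))) :
    f (x + α • p) ≤ f x + ρ * α * ⟪p, gradient f x⟫ := by
  have hline : ∀ t : ℝ, HasDerivAt (fun t : ℝ => x + t • p) p t := fun t => by
    simpa using ((hasDerivAt_id t).smul_const p).const_add x
  have hd1 : ∀ t : ℝ, HasDerivAt (fun t : ℝ => f (x + t • p)) ⟪gradient f (x + t • p), p⟫ t := by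
    intro t
    have h := ((hf.differentiable (by norm_num)) (x + t • p)).hasGradientAt.hasFDerivAt
    simpa [Function.comp_def] using h.comp_hasDerivAt t (hline t)
  have hd2 : ∀ t : ℝ, HasDerivAt (fun t : ℝ => ⟪gradient f (x + t • p), p⟫)
      ⟪hessian f (x + t • p) p, p⟫ t := by
    intro t
    have h := (hasFDerivAt_gradient_of_contDiff hf (x + t • p)).comp_hasDerivAt t (hline t)
    simpa using h.inner ℝ (hasDerivAt_const t p)
  have hnorm : ‖p‖ = s * ‖gradient f x‖ := by
    rw [hp, norm_neg, norm_smul, Real.norm_of_nonneg hs0.le]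
  have hpos : 0 < ‖p‖ := hnorm ▸ mul_pos hs0 (norm_pos_iff.mpr hgx)
  have hcurv : ∀ t : ℝ, 0 ≤ t →
      ⟪hessian f (x + t • p) p, p⟫ ≤ ⟪p, hessian f x p⟫ + L₂ * ‖p‖ ^ 3 * t := by
    intro t ht
    have hx : x + t • p = x - (t * s) • gradient f x := by
      rw [hp, smul_neg, smul_smul, sub_eq_add_neg]
    have h := hsmooth x (t * s) (by positivity)
    rw [← hx] at h
    have hdiff : ⟪(hessian f (x + t • p) - hessian f x) p, p⟫ ≤ L₂ * ‖p‖ ^ 3 * t :=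
      calc _ ≤ ‖(hessian f (x + t • p) - hessian f x) p‖ * ‖p‖ := real_inner_le_norm _ _
        _ ≤ t * s * L₂ * ‖gradient f x‖ * ‖p‖ * ‖p‖ := by
          gcongr
          exact ContinuousLinearMap.le_of_opNorm_le _ h p
        _ = L₂ * ‖p‖ ^ 3 * t := by rw [hnorm]; ring
    rw [sub_apply, inner_sub_left, real_inner_comm p (hessian f x p)] at hdiff
    linarith
  have htaylor := taylor_upper_bound hd1 hd2 hcurv hα0.le
  simp only [zero_smul, add_zero] at htaylor
  have hslope : σ * ‖p‖ ^ 2 ≤ -⟪gradient f x, p⟫ := by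
    have hG : -⟪gradient f x, p⟫ = s * ‖gradient f x‖ ^ 2 := by
      rw [hp, inner_neg_right, real_inner_smul_right, real_inner_self_eq_norm_sq, neg_neg]
    have hσs : s * σ ≤ 1 := (le_div_iff₀ hσ).mp hs1
    rw [hG, hnorm]
    calc _ = s * σ * (s * ‖gradient f x‖ ^ 2) := by ring
      _ ≤ 1 * (s * ‖gradient f x‖ ^ 2) := by gcongr
      _ = _ := one_mul _
  have hα_one : α ≤ 1 := hα1.trans (min_le_left _ _)
  have hα_sq : α ^ 2 * (L₂ * ‖p‖) ≤ 6 * σ * (1 / 2 - ρ) :=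
    (le_div_iff₀ (by positivity)).mp ((Real.le_sqrt' hα0).mp (hα1.trans (min_le_right _ _)))
  have hquad : ⟪p, hessian f x p⟫ * α ^ 2 ≤ -⟪gradient f x, p⟫ * α := by
    have hG : 0 ≤ -⟪gradient f x, p⟫ := le_trans (by positivity) hslope
    calc _ ≤ -⟪gradient f x, p⟫ * α ^ 2 := by gcongr; linarith
      _ ≤ _ := by gcongr; nlinarith
  have hcubic : L₂ * ‖p‖ ^ 3 * α ^ 3 ≤ 6 * (1 / 2 - ρ) * α * -⟪gradient f x, p⟫ := by
    have hρ' : 0 ≤ 1 / 2 - ρ := sub_nonneg.mpr hρ.2.le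
    calc _ = α ^ 2 * (L₂ * ‖p‖) * (‖p‖ ^ 2 * α) := by ring
      _ ≤ 6 * σ * (1 / 2 - ρ) * (‖p‖ ^ 2 * α) := by gcongr
      _ = 6 * (1 / 2 - ρ) * α * (σ * ‖p‖ ^ 2) := by ring
      _ ≤ _ := by gcongr
  rw [real_inner_comm (gradient f x) p]
  linarith
end

section
/- Let f : ℝ^d → ℝ be twice continuously differentiable and satisfy Hessian directional smoothness with constant L₂ > 0, and let ρ ∈ (0, 1). Fix x with g(x) ≠ 0 and suppose ⟨g(x), H(x) g(x)⟩ < 0 (negative curvature along the gradient). Let p = −s g(x) with s > 0. Then every step size α with 0 < α ≤ √(6(1 − ρ)/(L₂ s ‖p‖)) satisfies the Armijo condition f(x + α p) ≤ f(x) + ρ α ⟨p, g(x)⟩. -/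
open scoped RealInnerProductSpace

/-- A function on the line whose derivative is nonpositive on `[0, ∞)` stays below its value
at `0`. -/
theorem le_apply_zero_of_hasDerivAt_nonpos {h h' : ℝ → ℝ} (hd : ∀ t, HasDerivAt h (h' t) t)
    (hn : ∀ t, 0 ≤ t → h' t ≤ 0) {t : ℝ} (ht : 0 ≤ t) : h t ≤ h 0 := by
  have hanti : AntitoneOn h (Set.Ici 0) := by
    refine antitoneOn_of_deriv_nonpos (convex_Ici 0)
      (fun u _ => (hd u).continuousAt.continuousWithinAt)
      (fun u _ => (hd u).differentiableAt.differentiableWithinAt) fun u hu => ?_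
    rw [(hd u).deriv]
    exact hn u (interior_subset hu)
  exact hanti Set.self_mem_Ici ht ht

/-- The gradient of a twice continuously differentiable function is differentiable. -/
theorem ContDiff.differentiable_gradient {d : ℕ} {f : EuclideanSpace ℝ (Fin d) → ℝ}
    (hf : ContDiff ℝ 2 f) : Differentiable ℝ (gradient f) := by
  have h : ContDiff ℝ 1 (fderiv ℝ f) := hf.fderiv_right (by norm_num)
  exact (InnerProductSpace.toDual ℝ (EuclideanSpace ℝ (Fin d))).symm.differentiable.comp
    (h.differentiable (by norm_num))

/-- Cubic upper bound along the negative gradient ray, at a point where the curvature along the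
gradient is nonpositive. -/
theorem apply_sub_smul_gradient_le {d : ℕ} {f : EuclideanSpace ℝ (Fin d) → ℝ}
    (hf : ContDiff ℝ 2 f) {L : ℝ} {x : EuclideanSpace ℝ (Fin d)}
    (hsmooth : ∀ t : ℝ, 0 ≤ t →
      ‖hessian f (x - t • gradient f x) - hessian f x‖ ≤ t * L * ‖gradient f x‖)
    (hNC : ⟪gradient f x, hessian f x (gradient f x)⟫ ≤ 0) {t : ℝ} (ht : 0 ≤ t) :
    f (x - t • gradient f x) ≤
      f x - t * ‖gradient f x‖ ^ 2 + t ^ 3 / 6 * (L * ‖gradient f x‖ ^ 3) := by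
  set g := gradient f x with hg
  have hray (u : ℝ) : HasDerivAt (fun u : ℝ => x - u • g) (-g) u := by
    simpa using ((hasDerivAt_id u).smul_const g).const_sub x
  have hd₁ (u : ℝ) : HasDerivAt (fun u : ℝ => f (x - u • g)) (-⟪g, gradient f (x - u • g)⟫) u := by
    have h := ((hf.differentiable (by norm_num)) (x - u • g)).hasGradientAt.hasFDerivAt
    simpa [Function.comp_def, real_inner_comm] using h.comp_hasDerivAt u (hray u)
  have hd₂ (u : ℝ) : HasDerivAt (fun u : ℝ => ⟪g, gradient f (x - u • g)⟫)
      (-⟪g, hessian f (x - u • g) g⟫) u := by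
    have h := (hf.differentiable_gradient (x - u • g)).hasFDerivAt.comp_hasDerivAt u (hray u)
    simpa [hessian, Function.comp_def] using (hasDerivAt_const u g).inner ℝ h
  have hcurv (u : ℝ) (hu : 0 ≤ u) : ⟪g, hessian f (x - u • g) g⟫ ≤ u * (L * ‖g‖ ^ 3) := by
    have h : ⟪g, (hessian f (x - u • g) - hessian f x) g⟫ ≤ u * (L * ‖g‖ ^ 3) :=
      calc _ ≤ ‖g‖ * ‖(hessian f (x - u • g) - hessian f x) g‖ := real_inner_le_norm _ _
        _ ≤ ‖g‖ * ((u * L * ‖g‖) * ‖g‖) := by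
          gcongr
          exact ContinuousLinearMap.le_of_opNorm_le _ (hsmooth u hu) g
        _ = _ := by ring
    rw [sub_apply, inner_sub_right] at h
    linarith
  have hslope (u : ℝ) (hu : 0 ≤ u) :
      -⟪g, gradient f (x - u • g)⟫ + ‖g‖ ^ 2 - u ^ 2 / 2 * (L * ‖g‖ ^ 3) ≤ 0 := by
    have h := le_apply_zero_of_hasDerivAt_nonpos
      (fun v => (hd₂ v).neg.sub
        (((hasDerivAt_pow 2 v).div_const 2).mul_const (L * ‖g‖ ^ 3)))
      (fun v hv => by have := hcurv v hv; norm_num; linarith) hu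
    have h₀ : ⟪g, gradient f x⟫ = ‖g‖ ^ 2 := real_inner_self_eq_norm_sq g
    simp [h₀, -inner_gradient_right] at h
    linarith
  have h := le_apply_zero_of_hasDerivAt_nonpos
    (fun v => ((hd₁ v).add ((hasDerivAt_id v).mul_const (‖g‖ ^ 2))).sub
      (((hasDerivAt_pow 3 v).div_const 6).mul_const (L * ‖g‖ ^ 3)))
    (fun v hv => by have := hslope v hv; norm_num [-inner_gradient_right]; linarith) ht
  simp at h
  linarith

/-- Small enough step sizes satisfy the Armijo condition in the
negative curvature case. -/
theorem stmt_7 {d : ℕ} (f : EuclideanSpace ℝ (Fin d) → ℝ) (hf : ContDiff ℝ 2 f)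
    (L₂ : ℝ) (hL₂ : 0 < L₂)
    (hsmooth : ∀ x : EuclideanSpace ℝ (Fin d), ∀ t : ℝ, 0 ≤ t →
      ‖hessian f (x - t • gradient f x) - hessian f x‖ ≤ t * L₂ * ‖gradient f x‖)
    (ρ : ℝ) (hρ : ρ ∈ Set.Ioo (0 : ℝ) 1)
    (x : EuclideanSpace ℝ (Fin d)) (hgx : gradient f x ≠ 0)
    (hNC : ⟪gradient f x, hessian f x (gradient f x)⟫ < 0)
    (s : ℝ) (hs0 : 0 < s)
    (p : EuclideanSpace ℝ (Fin d)) (hp : p = -(s • gradient f x))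
    (α : ℝ) (hα0 : 0 < α)
    (hα1 : α ≤ Real.sqrt (6 * (1 - ρ) / (L₂ * s * ‖p‖))) :
    f (x + α • p) ≤ f x + ρ * α * ⟪p, gradient f x⟫ := by
  have hg : 0 < ‖gradient f x‖ := norm_pos_iff.mpr hgx
  have hbound := apply_sub_smul_gradient_le hf (hsmooth x) hNC.le (mul_pos hα0 hs0).le
  have hstep : x + α • p = x - (α * s) • gradient f x := by
    rw [hp, smul_neg, smul_smul, sub_eq_add_neg]
  have hinner : ⟪p, gradient f x⟫ = -(s * ‖gradient f x‖ ^ 2) := by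
    rw [hp, inner_neg_left, real_inner_smul_left, real_inner_self_eq_norm_sq]
  have hnorm : ‖p‖ = s * ‖gradient f x‖ := by
    rw [hp, norm_neg, norm_smul, Real.norm_of_nonneg hs0.le]
  have hsq : (α * s) ^ 2 * (L₂ * ‖gradient f x‖) ≤ 6 * (1 - ρ) := by
    rw [hnorm, Real.le_sqrt' hα0, le_div_iff₀ (by positivity)] at hα1
    linarith
  have hmul := mul_le_mul_of_nonneg_left hsq
    (by positivity : 0 ≤ α * s * ‖gradient f x‖ ^ 2)
  rw [hstep, hinner]
  linarith
end

section
/- (Sufficient condition for acceptance of the unit step size.) Let f : ℝ^d → ℝ be twice continuously differentiable and satisfy Hessian directional smoothness with constant L₂ > 0, let ρ ∈ (0, 1/2), σ > 0, and s_NC_max > 0. Fix x with g(x) ≠ 0 and let p = −s g(x) with s > 0, where either (i) ⟨g(x), H(x) g(x)⟩ ≥ 0 and s ≤ 1/σ and ⟨g(x), p⟩ + ⟨p, H(x) p⟩ ≤ 0 (the SPC/LPC cases), or (ii) ⟨g(x), H(x) g(x)⟩ < 0 and s ≤ s_NC_max (the NC case). If ‖g(x)‖ ≤ min{6σ²(1/2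 − ρ)/L₂, 6(1 − ρ)/(L₂ s_NC_max²)}, then the Armijo condition is satisfied with unit step size α = 1: f(x + p) ≤ f(x) + ρ ⟨p, g(x)⟩. -/
open scoped RealInnerProductSpace

/-- Third-order Taylor upper bound on `[0, ∞)` from an affine bound on the second derivative. -/
theorem le_cubic_of_second_deriv_le_affine {φ φ' φ'' : ℝ → ℝ} {a b s : ℝ}
    (hφ : ∀ t, HasDerivAt φ (φ' t) t) (hφ' : ∀ t, HasDerivAt φ' (φ'' t) t)
    (hbound : ∀ t, 0 ≤ t → φ'' t ≤ a + b * t) (hs : 0 ≤ s) :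
    φ s ≤ φ 0 + φ' 0 * s + a * s ^ 2 / 2 + b * s ^ 3 / 6 := by
  have hquad (c t : ℝ) : HasDerivAt (fun t => c * t ^ 2 / 2) (c * t) t := by
    refine (((hasDerivAt_pow 2 t).const_mul c).div_const 2).congr_deriv ?_
    norm_num
    ring
  have hcubic (c t : ℝ) : HasDerivAt (fun t => c * t ^ 3 / 6) (c * t ^ 2 / 2) t := by
    refine (((hasDerivAt_pow 3 t).const_mul c).div_const 6).congr_deriv ?_
    norm_num
    ring
  have hlin (c t : ℝ) : HasDerivAt (fun t => c * t) c t := by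
    simpa using (hasDerivAt_id t).const_mul c
  have hfirst (t : ℝ) (ht : 0 ≤ t) : φ' t ≤ φ' 0 + a * t + b * t ^ 2 / 2 := by
    have hB (u : ℝ) :
        HasDerivAt (fun u => φ' 0 + a * u + b * u ^ 2 / 2) (a + b * u) u :=
      ((hlin a u).const_add (φ' 0)).add (hquad b u)
    exact image_le_of_deriv_right_le_deriv_boundary
      (fun u _ => (hφ' u).continuousAt.continuousWithinAt)
      (fun u _ => (hφ' u).hasDerivWithinAt) (by simp)
      (fun u _ => (hB u).continuousAt.continuousWithinAt)
      (fun u _ => (hB u).hasDerivWithinAt) (fun u hu => hbound u hu.1)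
      (Set.right_mem_Icc.2 ht)
  have hB (u : ℝ) : HasDerivAt (fun u => φ 0 + φ' 0 * u + a * u ^ 2 / 2 + b * u ^ 3 / 6)
      (φ' 0 + a * u + b * u ^ 2 / 2) u :=
    (((hlin (φ' 0) u).const_add (φ 0)).add (hquad a u)).add (hcubic b u)
  exact image_le_of_deriv_right_le_deriv_boundary
    (fun u _ => (hφ u).continuousAt.continuousWithinAt)
    (fun u _ => (hφ u).hasDerivWithinAt) (by simp)
    (fun u _ => (hB u).continuousAt.continuousWithinAt)
    (fun u _ => (hB u).hasDerivWithinAt) (fun u hu => hfirst u hu.1)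
    (Set.right_mem_Icc.2 hs)

theorem ContDiff.differentiable_gradient_s8 {F : Type*} [NormedAddCommGroup F]
    [InnerProductSpace ℝ F] [CompleteSpace F] {f : F → ℝ} (hf : ContDiff ℝ 2 f) :
    Differentiable ℝ (gradient f) :=
  (InnerProductSpace.toDual ℝ F).symm.differentiable.comp
    ((hf.fderiv_right (m := 1) (by norm_num)).differentiable (by norm_num))

/-- Descent lemma for a negative gradient step under Hessian directional smoothness at `x`. -/
theorem gradient_step_le {d : ℕ} {f : EuclideanSpace ℝ (Fin d) → ℝ} (hf : ContDiff ℝ 2 f)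
    {L : ℝ} {x : EuclideanSpace ℝ (Fin d)}
    (hsmooth : ∀ t : ℝ, 0 ≤ t →
      ‖hessian f (x - t • gradient f x) - hessian f x‖ ≤ t * L * ‖gradient f x‖)
    {s : ℝ} (hs : 0 ≤ s) :
    f (x - s • gradient f x) ≤ f x - s * ‖gradient f x‖ ^ 2
      + s ^ 2 / 2 * ⟪gradient f x, hessian f x (gradient f x)⟫
      + L * s ^ 3 / 6 * ‖gradient f x‖ ^ 3 := by
  set g := gradient f x with hg
  have hline (t : ℝ) : HasDerivAt (fun t : ℝ => x - t • g) (-g) t := by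
    simpa using ((hasDerivAt_id t).smul_const g).const_sub x
  have hφ (t : ℝ) :
      HasDerivAt (fun t : ℝ => f (x - t • g)) (-⟪gradient f (x - t • g), g⟫) t := by
    have h := ((hf.differentiable (by norm_num)
      (x - t • g)).hasGradientAt.hasFDerivAt).comp_hasDerivAt t (hline t)
    exact h.congr_deriv (by simp)
  have hφ' (t : ℝ) : HasDerivAt (fun t : ℝ => -⟪gradient f (x - t • g), g⟫)
      ⟪g, hessian f (x - t • g) g⟫ t := by
    have h := (hf.differentiable_gradient_s8 (x - t • g)).hasFDerivAt.comp_hasDerivAt t (hline t)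
    have h' := (h.inner ℝ (hasDerivAt_const t g)).neg
    refine h'.congr_deriv ?_
    simp [hessian, real_inner_comm]
  have hbound (t : ℝ) (ht : 0 ≤ t) :
      ⟪g, hessian f (x - t • g) g⟫ ≤ ⟪g, hessian f x g⟫ + L * ‖g‖ ^ 3 * t := by
    have h : ⟪g, (hessian f (x - t • g) - hessian f x) g⟫ ≤ L * ‖g‖ ^ 3 * t :=
      calc ⟪g, (hessian f (x - t • g) - hessian f x) g⟫
          ≤ ‖g‖ * ‖(hessian f (x - t • g) - hessian f x) g‖ := real_inner_le_norm _ _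
        _ ≤ ‖g‖ * (t * L * ‖g‖ * ‖g‖) := by
          gcongr
          exact ContinuousLinearMap.le_of_opNorm_le _ (hsmooth t ht) g
        _ = L * ‖g‖ ^ 3 * t := by ring
    rw [sub_apply, inner_sub_right] at h
    linarith
  have h := le_cubic_of_second_deriv_le_affine hφ hφ' hbound hs
  simp only [zero_smul, sub_zero, ← hg, real_inner_self_eq_norm_sq] at h
  linarith

/-- Sufficient condition for acceptance of the unit step size. -/
theorem stmt_8 {d : ℕ} (f : EuclideanSpace ℝ (Fin d) → ℝ) (hf : ContDiff ℝ 2 f)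
    (L₂ : ℝ) (hL₂ : 0 < L₂)
    (hsmooth : ∀ x : EuclideanSpace ℝ (Fin d), ∀ t : ℝ, 0 ≤ t →
      ‖hessian f (x - t • gradient f x) - hessian f x‖ ≤ t * L₂ * ‖gradient f x‖)
    (ρ σ sNCmax : ℝ) (hρ : ρ ∈ Set.Ioo (0 : ℝ) (1 / 2)) (hσ : 0 < σ)
    (hsNCmax : 0 < sNCmax)
    (x : EuclideanSpace ℝ (Fin d)) (hgx : gradient f x ≠ 0)
    (s : ℝ) (hs0 : 0 < s)
    (p : EuclideanSpace ℝ (Fin d)) (hp : p = -(s • gradient f x))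
    (hcase :
      (0 ≤ ⟪gradient f x, hessian f x (gradient f x)⟫ ∧ s ≤ 1 / σ ∧
        ⟪gradient f x, p⟫ + ⟪p, hessian f x p⟫ ≤ 0) ∨
      (⟪gradient f x, hessian f x (gradient f x)⟫ < 0 ∧ s ≤ sNCmax))
    (hgnorm : ‖gradient f x‖ ≤
      min (6 * σ ^ 2 * (1 / 2 - ρ) / L₂) (6 * (1 - ρ) / (L₂ * sNCmax ^ 2))) :
    f (x + p) ≤ f x + ρ * ⟪p, gradient f x⟫ := by
  obtain ⟨hG₁, hG₂⟩ := le_min_iff.1 hgnorm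
  rw [le_div_iff₀ hL₂] at hG₁
  rw [le_div_iff₀ (by positivity)] at hG₂
  have hdescent := gradient_step_le hf (hsmooth x) hs0.le
  have hG : 0 < ‖gradient f x‖ := norm_pos_iff.2 hgx
  subst hp
  simp only [map_neg, map_smul, inner_neg_left, inner_neg_right, inner_smul_left,
    inner_smul_right, real_inner_self_eq_norm_sq, conj_trivial] at hcase ⊢
  rw [← sub_eq_add_neg]
  set G := ‖gradient f x‖
  set h := ⟪gradient f x, hessian f x (gradient f x)⟫
  rcases hcase with ⟨-, hs, hcurv⟩ | ⟨hneg, hs⟩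
  · have hsσ : s * σ ≤ 1 := (le_div_iff₀ hσ).1 hs
    have hsσ2 : s ^ 2 * σ ^ 2 ≤ 1 := by
      rw [← mul_pow]
      exact pow_le_one₀ (by positivity) hsσ
    have hstep : s ^ 2 * (G * L₂) ≤ 6 * (1 / 2 - ρ) := by
      nlinarith [mul_le_mul_of_nonneg_left hG₁ (sq_nonneg s),
        mul_le_mul_of_nonneg_right hsσ2 (sub_nonneg.2 hρ.2.le)]
    nlinarith [mul_le_mul_of_nonneg_left hstep (by positivity : 0 ≤ s * G ^ 2)]
  · have hs2 : s ^ 2 ≤ sNCmax ^ 2 := by gcongr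
    have hstep : s ^ 2 * (G * L₂) ≤ 6 * (1 - ρ) := by
      nlinarith [mul_le_mul_of_nonneg_right hs2 (by positivity : 0 ≤ G * L₂)]
    nlinarith [mul_le_mul_of_nonneg_left hstep (by positivity : 0 ≤ s * G ^ 2),
      mul_nonneg (sq_nonneg s) (neg_nonneg.2 hneg.le)]
end
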